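/- Let R be a commutative ring and S̄ a finitely presented R-algebra. Let 𝔭̄ be a prime ideal of S̄ with contraction 𝔭' to R. If the induced map R_{𝔭'} → S̄_{𝔭̄} of localizations is formally smooth, then there exists g ∈ S̄ \ 𝔭̄ such that the principal localization S̄_g is a standard smooth R-algebra. -/

import Mathlib

/-- An `R`-algebra `S` is *standard smooth* if `S ≅ R[x_1,…,x_n]/(f_1,…,f_c)` with
`c ≤ n` such that the `c × c` matrix with `(i,j)`-entry the image of `∂f_i/∂x_j`
(`1 ≤ i, j ≤ c`) has determinant invertible in `S` (equivalently, in the quotient). -/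
def StandardSmoothAlgebra (R S : Type) [CommRing R] [CommRing S] [Algebra R S] : Prop :=
  ∃ (n c : ℕ) (hcn : c ≤ n) (f : Fin c → MvPolynomial (Fin n) R)
    (_ : (MvPolynomial (Fin n) R ⧸ Ideal.span (Set.range f)) ≃ₐ[R] S),
    IsUnit (Matrix.det (Matrix.of fun i j : Fin c =>
      Ideal.Quotient.mk (Ideal.span (Set.range f))
        (MvPolynomial.pderiv (Fin.castLE hcn j) (f i))))

theorem Function.Injective.exists_perm_apply_eq {α β : Type*} [Finite β] {f g : α → β}
    (hf : Function.Injective f) (hg : Function.Injective g) :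
    ∃ e : Equiv.Perm β, ∀ a, e (f a) = g a := by
  classical
  cases nonempty_fintype β
  refine ⟨((Equiv.ofInjective f hf).symm.trans (Equiv.ofInjective g hg)).extendSubtype,
    fun a => ?_⟩
  rw [Equiv.extendSubtype_apply_of_mem _ _ ⟨a, rfl⟩]
  simp [Equiv.ofInjective_symm_apply]

namespace Algebra.SubmersivePresentation

/-- A submersive presentation whose relation `i` is paired with the variable `i`
exhibits a standard smooth algebra. -/
theorem standardSmoothAlgebra_of_map_eq_castLE {R S : Type} [CommRing R] [CommRing S]
    [Algebra R S] {n c : ℕ} (hcn : c ≤ n) (P : SubmersivePresentation R S (Fin n) (Fin c))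
    (hmap : ∀ i, P.map i = Fin.castLE hcn i) : StandardSmoothAlgebra R S := by
  let e : (MvPolynomial (Fin n) R ⧸ Ideal.span (Set.range P.relation)) ≃ₐ[R] S :=
    (Ideal.quotientEquivAlgOfEq R P.span_range_relation_eq_ker).trans
      (P.quotientEquiv.restrictScalars R)
  refine ⟨n, c, hcn, P.relation, e, ?_⟩
  rw [← MulEquiv.isUnit_map e]
  have h := P.jacobian_isUnit
  rw [P.jacobian_eq_jacobiMatrix_det, ← Matrix.det_transpose, RingHom.map_det] at h
  rw [AlgEquiv.map_det]
  convert! h using 2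
  ext i j
  simp only [AlgEquiv.mapMatrix_apply, RingHom.mapMatrix_apply, Matrix.map_apply, Matrix.of_apply,
    Matrix.transpose_apply, PreSubmersivePresentation.jacobiMatrix_apply, hmap]
  rfl

end Algebra.SubmersivePresentation

theorem Algebra.IsStandardSmooth.standardSmoothAlgebra {R S : Type} [CommRing R] [CommRing S]
    [Algebra R S] [Algebra.IsStandardSmooth R S] : StandardSmoothAlgebra R S := by
  obtain ⟨ι, σ, _, _, ⟨P⟩⟩ := Algebra.IsStandardSmooth.out (R := R) (S := S)
  let eι := Finite.equivFin ι
  let eσ := Finite.equivFin σ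
  have hcn : Nat.card σ ≤ Nat.card ι := P.card_relations_le_card_vars_of_isFinite
  obtain ⟨e, he⟩ := (Fin.castLE_injective hcn).exists_perm_apply_eq
    (eι.injective.comp (P.map_inj.comp eσ.symm.injective))
  refine (P.reindex (e.trans eι.symm) eσ.symm).standardSmoothAlgebra_of_map_eq_castLE hcn
    fun i => ?_
  change (e.trans eι.symm).symm (P.map (eσ.symm i)) = _
  rw [Equiv.symm_apply_eq, Equiv.trans_apply, he]
  simp

/-- Let `S̄` be a finitely presented `R`-algebra and `𝔭̄` a prime of
`S̄` with contraction `𝔭'` to `R`. If the induced map `R_{𝔭'} → S̄_{𝔭̄}` is formally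
smooth, then there is `g ∈ S̄ \ 𝔭̄` such that `S̄_g` is a standard smooth `R`-algebra. -/
theorem exists_away_standardSmooth_of_formallySmooth_atPrime
    {R S : Type} [CommRing R] [CommRing S] [Algebra R S]
    (hfp : Algebra.FinitePresentation R S) (𝔭 : Ideal S) [𝔭.IsPrime]
    (hsm :
      letI : Algebra (Localization.AtPrime (𝔭.comap (algebraMap R S)))
          (Localization.AtPrime 𝔭) :=
        (Localization.localRingHom (𝔭.comap (algebraMap R S)) 𝔭 (algebraMap R S)
          rfl).toAlgebra
      Algebra.FormallySmooth (Localization.AtPrime (𝔭.comap (algebraMap R S)))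
        (Localization.AtPrime 𝔭)) :
    ∃ g ∉ 𝔭, StandardSmoothAlgebra R (Localization.Away g) := by
  let : Algebra (Localization.AtPrime (𝔭.comap (algebraMap R S))) (Localization.AtPrime 𝔭) :=
    (Localization.localRingHom (𝔭.comap (algebraMap R S)) 𝔭 (algebraMap R S) rfl).toAlgebra
  have : IsScalarTower R (Localization.AtPrime (𝔭.comap (algebraMap R S)))
      (Localization.AtPrime 𝔭) := .of_algebraMap_eq fun r => by
    rw [RingHom.algebraMap_toAlgebra, Localization.localRingHom_to_map,
      ← IsScalarTower.algebraMap_apply]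
  have : Algebra.FormallySmooth R (Localization.AtPrime (𝔭.comap (algebraMap R S))) :=
    .of_isLocalization (𝔭.comap (algebraMap R S)).primeCompl
  have : Algebra.IsSmoothAt R 𝔭 :=
    .comp R (Localization.AtPrime (𝔭.comap (algebraMap R S))) (Localization.AtPrime 𝔭)
  obtain ⟨g, hg, _⟩ := Algebra.IsSmoothAt.exists_notMem_isStandardSmooth R 𝔭
  exact ⟨g, hg, Algebra.IsStandardSmooth.standardSmoothAlgebra⟩
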